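/- arXiv:2601.04256 — 13 statements merged into one kernel-verified Lean document; each statement's English description precedes it below -/
import Mathlib

section
/- Let X be a topological space and A ⊆ X. Then A is monitorable if and only if there exists an open set U ⊆ X such that the symmetric difference A △ U is nowhere dense. Moreover, if A is monitorable, then the set V = interior(closure(A)) is regular open, A △ V is nowhere dense, V is the unique regular open set whose symmetric difference with A is nowhere dense, and V contains every open set O with A △ O nowhere dense. -/
/-- A subset `A` of a topological space is *monitorable* if there is no nonempty open set
`U` such that `U ⊆ closure A` and `U ⊆ closure Aᶜ`. -/
def Monitorable {X : Type*} [TopologicalSpace X] (A : Set X) : Prop :=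
  ¬ ∃ U : Set X, IsOpen U ∧ U.Nonempty ∧ U ⊆ closure A ∧ U ⊆ closure Aᶜ

/-- The frontier of a monitorable set is nowhere dense. -/
theorem Monitorable.isNowhereDense_frontier {X : Type*} [TopologicalSpace X] {A : Set X}
    (h : Monitorable A) : IsNowhereDense (frontier A) := by
  rw [IsNowhereDense, isClosed_frontier.closure_eq, ← Set.not_nonempty_iff_eq_empty]
  intro hne
  have hsub : interior (frontier A) ⊆ closure A ∩ closure Aᶜ := by
    rw [← frontier_eq_closure_inter_closure]
    exact interior_subset
  exact h ⟨_, isOpen_interior, hne, hsub.trans Set.inter_subset_left,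
    hsub.trans Set.inter_subset_right⟩

theorem symmDiff_interior_closure_subset_frontier {X : Type*} [TopologicalSpace X] (A : Set X) :
    symmDiff A (interior (closure A)) ⊆ frontier A := by
  rintro x (⟨hA, hx⟩ | ⟨hx, hA⟩)
  · exact ⟨subset_closure hA, fun h => hx (interior_mono subset_closure h)⟩
  · exact ⟨interior_subset hx, fun h => hA (interior_subset h)⟩

theorem IsNowhereDense.eq_empty_of_isOpen_subset_closure {X : Type*} [TopologicalSpace X]
    {s U : Set X} (hs : IsNowhereDense s) (hU : IsOpen U) (h : U ⊆ closure s) : U = ∅ :=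
  Set.subset_eq_empty (interior_maximal h hU) hs

theorem IsOpen.subset_interior_closure_of_isNowhereDense_symmDiff {X : Type*}
    [TopologicalSpace X] {A U : Set X} (hU : IsOpen U) (h : IsNowhereDense (symmDiff A U)) :
    U ⊆ interior (closure A) := by
  refine interior_maximal (Set.sdiff_eq_empty.1 ?_) hU
  refine h.eq_empty_of_isOpen_subset_closure (hU.sdiff isClosed_closure) ?_
  exact fun x hx => subset_closure (Or.inr ⟨hx.1, fun hA => hx.2 (subset_closure hA)⟩)

theorem interior_closure_subset_closure_of_isNowhereDense_symmDiff {X : Type*}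
    [TopologicalSpace X] {A U : Set X} (h : IsNowhereDense (symmDiff A U)) :
    interior (closure A) ⊆ closure U := by
  refine Set.sdiff_eq_empty.1 ?_
  refine h.eq_empty_of_isOpen_subset_closure (isOpen_interior.sdiff isClosed_closure) ?_
  rintro x ⟨hx, hxU⟩
  have hmem := isClosed_closure.isOpen_compl.inter_closure ⟨hxU, interior_subset hx⟩
  exact closure_mono (fun y hy => Or.inl ⟨hy.2, fun hyU => hy.1 (subset_closure hyU)⟩) hmem

theorem IsOpen.monitorable_of_isNowhereDense_symmDiff {X : Type*} [TopologicalSpace X]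
    {A U : Set X} (hU : IsOpen U) (h : IsNowhereDense (symmDiff A U)) : Monitorable A := by
  rintro ⟨W, hW, ⟨x, hx⟩, hWA, hWA'⟩
  have hWU : W ∩ U = ∅ := by
    refine h.eq_empty_of_isOpen_subset_closure (hW.inter hU) ?_
    rintro y ⟨hyW, hyU⟩
    exact closure_mono (fun z hz => Or.inr hz) (hU.inter_closure ⟨hyU, hWA' hyW⟩)
  have hxU : x ∈ closure U :=
    interior_closure_subset_closure_of_isNowhereDense_symmDiff h (interior_maximal hWA hW hx)
  exact (mem_closure_iff.1 hxU W hW hx).ne_empty hWU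

/-- `A` is monitorable iff its symmetric difference with some open set is nowhere dense;
moreover in that case `V = interior (closure A)` is the unique regular open set whose
symmetric difference with `A` is nowhere dense, and `V` contains every open set `O` with
`A ∆ O` nowhere dense. -/
theorem monitorable_iff_symmDiff_open_nowhereDense {X : Type*} [TopologicalSpace X] (A : Set X) :
    (Monitorable A ↔ ∃ U : Set X, IsOpen U ∧ IsNowhereDense (symmDiff A U)) ∧
    (Monitorable A →
      (IsOpen (interior (closure A)) ∧
        interior (closure A) = interior (closure (interior (closure A))) ∧
        IsNowhereDense (symmDiff A (interior (closure A))) ∧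
        (∀ V : Set X, IsOpen V → V = interior (closure V) →
          IsNowhereDense (symmDiff A V) → V = interior (closure A)) ∧
        (∀ O : Set X, IsOpen O → IsNowhereDense (symmDiff A O) →
          O ⊆ interior (closure A)))) := by
  have key : Monitorable A → IsNowhereDense (symmDiff A (interior (closure A))) := fun h =>
    h.isNowhereDense_frontier.mono (symmDiff_interior_closure_subset_frontier A)
  refine ⟨⟨fun h => ⟨_, isOpen_interior, key h⟩,
    fun ⟨U, hU, h⟩ => hU.monitorable_of_isNowhereDense_symmDiff h⟩, fun hA => ?_⟩
  refine ⟨isOpen_interior, ?_, key hA, fun V hV hreg h => ?_,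
    fun O hO h => hO.subset_interior_closure_of_isNowhereDense_symmDiff h⟩
  · exact (interior_maximal subset_closure isOpen_interior).antisymm
      (interior_mono (closure_minimal interior_subset isClosed_closure))
  · refine (hV.subset_interior_closure_of_isNowhereDense_symmDiff h).antisymm ?_
    exact (interior_maximal (interior_closure_subset_closure_of_isNowhereDense_symmDiff h)
      isOpen_interior).trans hreg.symm.subset
end

section
/- Let X be a countable, second countable topological space. Then the family of monitorable subsets of X is a Π⁰₃ subset of the powerset P(X): there exists a doubly-indexed family F : ℕ → ℕ → Set (P(X)) of closed subsets of P(X) (with P(X) carrying the product topology of 2^X) such that the set {A ⊆ X | A is monitorable} equals ⋂_n ⋃_m F(n, m). -/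
open TopologicalSpace in
/-- A set is monitorable iff every nonempty member of a given topological basis contains a
nonempty basis member on which the characteristic function of the set is constant. -/
theorem monitorable_iff_of_isTopologicalBasis {X : Type*} [TopologicalSpace X]
    {b : Set (Set X)} (hb : IsTopologicalBasis b) (f : X → Bool) :
    Monitorable {x : X | f x = true} ↔
      ∀ U ∈ b, U.Nonempty → ∃ V ∈ b, V.Nonempty ∧ V ⊆ U ∧ ∀ x ∈ V, ∀ y ∈ V, f x = f y := by
  constructor
  · intro h U hU hne
    by_contra! hV
    refine h ⟨U, hb.isOpen hU, hne, fun x hx => ?_, fun x hx => ?_⟩ <;>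
    · rw [mem_closure_iff]
      intro O hO hxO
      obtain ⟨V, hVb, hxV, hVO⟩ :=
        hb.exists_subset_of_mem_open (Set.mem_inter hxO hx) (hO.inter (hb.isOpen hU))
      obtain ⟨y, hy, z, hz, hyz⟩ := hV V hVb ⟨x, hxV⟩ (hVO.trans Set.inter_subset_right)
      cases hfy : f y <;> cases hfz : f z <;> first
        | exact absurd (hfy.trans hfz.symm) hyz
        | exact ⟨y, (hVO hy).1, hfy⟩
        | exact ⟨z, (hVO hz).1, hfz⟩
        | exact ⟨y, (hVO hy).1, fun h => Bool.false_ne_true (hfy.symm.trans h)⟩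
        | exact ⟨z, (hVO hz).1, fun h => Bool.false_ne_true (hfz.symm.trans h)⟩
  · rintro h ⟨O, hO, ⟨x, hx⟩, hA, hAc⟩
    obtain ⟨U, hU, hxU, hUO⟩ := hb.exists_subset_of_mem_open hx hO
    obtain ⟨V, hV, ⟨y, hy⟩, hVU, hc⟩ := h U hU ⟨x, hxU⟩
    have hyO := hUO (hVU hy)
    obtain ⟨u, huV, hu⟩ := mem_closure_iff.1 (hA hyO) V (hb.isOpen hV) hy
    obtain ⟨v, hvV, hv⟩ := mem_closure_iff.1 (hAc hyO) V (hb.isOpen hV) hy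
    exact hv ((hc v hvV u huV).trans hu)

/-- For a countable, second countable space `X`, the family of monitorable subsets of `X`
is a `Π⁰₃` subset of the powerset `P(X)`, identified with `X → Bool` with the product
topology (`Bool` discrete). -/
theorem monitorable_family_Pi03 {X : Type*} [TopologicalSpace X] [Countable X]
    [SecondCountableTopology X] :
    ∃ F : ℕ → ℕ → Set (X → Bool), (∀ n m, IsClosed (F n m)) ∧
      {f : X → Bool | Monitorable {x : X | f x = true}} = ⋂ n, ⋃ m, F n m := by
  have hb := (TopologicalSpace.isBasis_countableBasis X).insert_empty
  obtain ⟨g, hg⟩ := ((TopologicalSpace.countable_countableBasis X).insert ∅).exists_eq_range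
    (Set.insert_nonempty _ _)
  rw [hg] at hb
  refine ⟨fun n m => {f | (g n).Nonempty → (g m).Nonempty ∧ g m ⊆ g n ∧
    ∀ x ∈ g m, ∀ y ∈ g m, f x = f y}, fun n m => ?_, ?_⟩
  · refine isClosed_imp isOpen_const <| isClosed_const.inter <| isClosed_const.inter ?_
    change IsClosed {f : X → Bool | ∀ x ∈ g m, ∀ y ∈ g m, f x = f y}
    simp only [Set.ofPred_forall]
    exact isClosed_biInter fun x _ => isClosed_biInter fun y _ =>
      isClosed_eq (continuous_apply x) (continuous_apply y)
  · ext f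
    simp only [Set.mem_ofPred_eq, Set.mem_iInter, Set.mem_iUnion,
      monitorable_iff_of_isTopologicalBasis hb, Set.forall_mem_range, Set.exists_range_iff]
    exact forall_congr' fun n => by
      by_cases h : (g n).Nonempty <;> simp [h]
end

section
/- Let X be a second countable topological space. Then every subset of X is monitorable if and only if the set of isolated points of X is dense in X. -/
/-- A sequence of infinite sets has an injective choice function. -/
theorem exists_injective_forall_mem_of_infinite {α : Type*} (S : ℕ → Set α)
    (hS : ∀ n, (S n).Infinite) : ∃ f : ℕ → α, Function.Injective f ∧ ∀ n, f n ∈ S n := by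
  classical
  choose t ht hcard using fun n => (hS n).exists_subset_card_eq (n + 1)
  obtain ⟨f, hf, hft⟩ := (Finset.all_card_le_biUnion_card_iff_exists_injective t).1 (by
    intro s
    rcases s.eq_empty_or_nonempty with rfl | hs
    · simp
    calc s.card ≤ (Finset.range (s.max' hs + 1)).card :=
          Finset.card_le_card fun i hi =>
            Finset.mem_range.2 (Nat.lt_succ_of_le (s.le_max' i hi))
      _ = (t (s.max' hs)).card := by rw [Finset.card_range, hcard]
      _ ≤ (s.biUnion t).card :=
          Finset.card_le_card (Finset.subset_biUnion_of_mem t (s.max'_mem hs)))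
  exact ⟨f, hf, fun n => ht n (hft n)⟩

/-- A finite nonempty open set without isolated points contains a nonempty open set on which
some set is both dense and codense. -/
theorem exists_not_monitorable_of_finite {X : Type*} [TopologicalSpace X] {W : Set X}
    (hiso : ∀ x ∈ W, ¬ IsOpen ({x} : Set X)) (hW : IsOpen W) (hne : W.Nonempty)
    (hfin : W.Finite) : ∃ A : Set X, ¬ Monitorable A := by
  obtain ⟨F, ⟨hFW, hFo, hFne⟩, hmin⟩ :=
    (hfin.finite_subsets.subset (t := {F | F ⊆ W ∧ IsOpen F ∧ F.Nonempty})
      fun F hF => hF.1).exists_minimal ⟨W, subset_rfl, hW, hne⟩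
  have key : ∀ O : Set X, IsOpen O → ∀ z ∈ O, z ∈ F → F ⊆ O := fun O hO z hzO hzF =>
    (hmin ⟨Set.inter_subset_left.trans hFW, hFo.inter hO, z, hzF, hzO⟩
      Set.inter_subset_left).trans Set.inter_subset_right
  obtain ⟨x, hx⟩ := hFne
  obtain ⟨y, hy, hyx⟩ : ∃ y ∈ F, y ≠ x := by
    by_contra! h
    exact hiso x (hFW hx) (Set.eq_singleton_iff_unique_mem.2 ⟨hx, h⟩ ▸ hFo)
  exact ⟨{x}, not_not.2 ⟨F, hFo, ⟨x, hx⟩,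
    fun z hz => mem_closure_iff.2 fun O hO hzO => ⟨x, key O hO z hzO hz hx, rfl⟩,
    fun z hz => mem_closure_iff.2 fun O hO hzO => ⟨y, key O hO z hzO hz hy, hyx⟩⟩⟩

open TopologicalSpace in
/-- In a second countable space, if all nonempty open subsets of a nonempty open set `W` are
infinite, then some set is both dense and codense in `W`. -/
theorem exists_not_monitorable_of_infinite {X : Type*} [TopologicalSpace X]
    [SecondCountableTopology X] {W : Set X} (hW : IsOpen W) (hne : W.Nonempty)
    (hinf : ∀ O ⊆ W, IsOpen O → O.Nonempty → O.Infinite) : ∃ A : Set X, ¬ Monitorable A := by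
  have hB := isBasis_countableBasis X
  have hcount : {O ∈ countableBasis X | O ⊆ W}.Countable :=
    (countable_countableBasis X).mono fun O hO => hO.1
  obtain ⟨S, hS⟩ := hcount.exists_eq_range (by
    obtain ⟨x, hx⟩ := hne
    obtain ⟨O, hO, -, hOW⟩ := hB.exists_subset_of_mem_open hx hW
    exact ⟨O, hO, hOW⟩)
  have hSmem : ∀ n, S n ∈ countableBasis X ∧ S n ⊆ W := fun n =>
    hS.symm.subset (Set.mem_range_self n)
  obtain ⟨f, hf, hfS⟩ := exists_injective_forall_mem_of_infinite (fun k => S (k / 2)) fun k =>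
    hinf _ (hSmem _).2 (hB.isOpen (hSmem _).1) (nonempty_of_mem_countableBasis (hSmem _).1)
  have hsub : ∀ z ∈ W, ∀ O : Set X, IsOpen O → z ∈ O → ∃ n, S n ⊆ O := by
    intro z hz O hO hzO
    obtain ⟨V, hV, -, hVO⟩ := hB.exists_subset_of_mem_open
      (show z ∈ O ∩ W from ⟨hzO, hz⟩) (hO.inter hW)
    obtain ⟨n, rfl⟩ := hS.subset ⟨hV, hVO.trans Set.inter_subset_right⟩
    exact ⟨n, hVO.trans Set.inter_subset_left⟩
  refine ⟨Set.range fun n => f (2 * n), not_not.2 ⟨W, hW, hne, fun z hz => ?_, fun z hz => ?_⟩⟩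
  · refine mem_closure_iff.2 fun O hO hzO => ?_
    obtain ⟨n, hn⟩ := hsub z hz O hO hzO
    have h := hfS (2 * n)
    rw [show 2 * n / 2 = n by omega] at h
    exact ⟨f (2 * n), hn h, n, rfl⟩
  · refine mem_closure_iff.2 fun O hO hzO => ?_
    obtain ⟨n, hn⟩ := hsub z hz O hO hzO
    have h := hfS (2 * n + 1)
    rw [show (2 * n + 1) / 2 = n by omega] at h
    refine ⟨f (2 * n + 1), hn h, ?_⟩
    rintro ⟨m, hm⟩
    have := hf hm
    omega

/-- In a second countable space, every subset is monitorable iff the set of isolated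
points is dense. -/
theorem monitorable_all_iff_isolated_dense {X : Type*} [TopologicalSpace X]
    [SecondCountableTopology X] :
    (∀ A : Set X, Monitorable A) ↔ Dense {x : X | IsOpen ({x} : Set X)} := by
  constructor
  · intro h
    refine dense_iff_inter_open.2 fun W hW hne => ?_
    by_contra hempty
    have hiso : ∀ x ∈ W, ¬ IsOpen ({x} : Set X) := fun x hx hxo => hempty ⟨x, hx, hxo⟩
    suffices ∃ A : Set X, ¬ Monitorable A from this.elim fun A hA => hA (h A)
    by_cases hfin : ∃ O ⊆ W, IsOpen O ∧ O.Nonempty ∧ O.Finite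
    · obtain ⟨O, hOW, hO, hOne, hOfin⟩ := hfin
      exact exists_not_monitorable_of_finite (fun x hx => hiso x (hOW hx)) hO hOne hOfin
    · exact exists_not_monitorable_of_infinite hW hne fun O hOW hO hOne hOfin =>
        hfin ⟨O, hOW, hO, hOne, hOfin⟩
  · rintro hd A ⟨U, hU, hne, hUA, hUAc⟩
    obtain ⟨x, hxU, hx⟩ := hd.inter_open_nonempty U hU hne
    obtain ⟨_, rfl, hxA⟩ := mem_closure_iff.1 (hUA hxU) {x} hx rfl
    obtain ⟨_, rfl, hxAc⟩ := mem_closure_iff.1 (hUAc hxU) _ hx rfl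
    exact hxAc hxA
end

section
/- Let X = ℕ × ℕ be endowed with the Alexandrov topology of the partial order (m,n) ≼ (m',n') ⟺ m = m' ∧ n ≤ n', i.e., a set is open iff it is upward closed with respect to ≼. Then there exists a continuous function f : (ℕ × ℕ → Bool) → P(X) (where ℕ × ℕ → Bool carries the product topology with Bool discrete, and P(X) is identified with 2^X with the product topology) such that for every α : ℕ × ℕ → Bool, the set f(α) is monitorable in X if and only if for every m ∈ ℕ the set {n ∈ ℕ | α(m,n) = false} is finite. -/
open Topology

/-- In the columnwise Alexandrov topology on `ℕ × ℕ`, a point is adherent to `A` iff `A` has a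
point above it. -/
theorem mem_closure_iff_exists_le_of_columnwise (t : TopologicalSpace (ℕ × ℕ))
    (ht : ∀ U : Set (ℕ × ℕ),
      IsOpen[t] U ↔ ∀ p ∈ U, ∀ q : ℕ × ℕ, p.1 = q.1 → p.2 ≤ q.2 → q ∈ U)
    (A : Set (ℕ × ℕ)) (p : ℕ × ℕ) :
    p ∈ @closure _ t A ↔ ∃ n, p.2 ≤ n ∧ (p.1, n) ∈ A := by
  rw [@mem_closure_iff _ t]
  constructor
  · intro h
    obtain ⟨⟨m, n⟩, ⟨hm, hn⟩, hA⟩ := h {q | p.1 = q.1 ∧ p.2 ≤ q.2}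
      ((ht _).2 fun a ha b h₁ h₂ => ⟨ha.1.trans h₁, ha.2.trans h₂⟩) ⟨rfl, le_rfl⟩
    exact ⟨n, hn, by simpa [show p.1 = m from hm] using hA⟩
  · rintro ⟨n, hn, hA⟩ U hU hp
    exact ⟨(p.1, n), (ht U).1 hU p hp (p.1, n) rfl hn, hA⟩

/-- In the columnwise Alexandrov topology on `ℕ × ℕ`, a set is monitorable iff each of its columns
is finite or cofinite. -/
theorem monitorable_iff_columns_of_columnwise (t : TopologicalSpace (ℕ × ℕ))
    (ht : ∀ U : Set (ℕ × ℕ),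
      IsOpen[t] U ↔ ∀ p ∈ U, ∀ q : ℕ × ℕ, p.1 = q.1 → p.2 ≤ q.2 → q ∈ U)
    (A : Set (ℕ × ℕ)) :
    @Monitorable _ t A ↔ ∀ m, {n | (m, n) ∈ A}.Finite ∨ {n | (m, n) ∈ Aᶜ}.Finite := by
  have hcl := mem_closure_iff_exists_le_of_columnwise t ht
  have infinite_column {U B : Set (ℕ × ℕ)} {p : ℕ × ℕ} (hU : IsOpen[t] U) (hp : p ∈ U)
      (hB : U ⊆ @closure _ t B) : {n | (p.1, n) ∈ B}.Infinite := by
    refine Set.infinite_of_forall_exists_gt fun k => ?_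
    have hq := (ht U).1 hU p hp (p.1, max p.2 (k + 1)) rfl (le_max_left _ _)
    obtain ⟨n, hn, hnB⟩ := (hcl B _).1 (hB hq)
    exact ⟨n, hnB, (le_max_right _ _).trans hn⟩
  have column_subset {B : Set (ℕ × ℕ)} {m : ℕ} (hB : {n | (m, n) ∈ B}.Infinite) :
      {q : ℕ × ℕ | q.1 = m} ⊆ @closure _ t B := by
    rintro ⟨_, k⟩ rfl
    obtain ⟨n, hnB, hn⟩ := hB.exists_gt k
    exact (hcl B _).2 ⟨n, hn.le, hnB⟩
  constructor
  · intro h m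
    by_contra! hm
    exact h ⟨{q | q.1 = m}, (ht _).2 fun a ha b h₁ _ => h₁.symm.trans ha, ⟨(m, 0), rfl⟩,
      column_subset hm.1, column_subset hm.2⟩
  · rintro h ⟨U, hU, ⟨p, hp⟩, hA, hAc⟩
    exact (h p.1).elim (infinite_column hU hp hA) (infinite_column hU hp hAc)

/-- On `ℕ × ℕ` with the Alexandrov topology of the order `(m,n) ≼ (m',n') ↔ m = m' ∧ n ≤ n'`
(open = upward closed), there is a continuous `f : (ℕ × ℕ → Bool) → P(ℕ × ℕ)` such that
`f α` is monitorable iff for every `m` the set `{n | α (m, n) = false}` is finite. -/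
theorem monitorable_Pi03_hard_alexandrov (t : TopologicalSpace (ℕ × ℕ))
    (ht : ∀ U : Set (ℕ × ℕ),
      IsOpen[t] U ↔ ∀ p ∈ U, ∀ q : ℕ × ℕ, p.1 = q.1 → p.2 ≤ q.2 → q ∈ U) :
    ∃ f : (ℕ × ℕ → Bool) → (ℕ × ℕ → Bool), Continuous f ∧
      ∀ α : ℕ × ℕ → Bool,
        (@Monitorable (ℕ × ℕ) t {p : ℕ × ℕ | f α p = true} ↔
          ∀ m : ℕ, {n : ℕ | α (m, n) = false}.Finite) := by
  refine ⟨fun α p => decide (p.2 % 2 = 1) && !α (p.1, p.2 / 2), ?_, fun α => ?_⟩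
  · exact continuous_pi fun p =>
      (continuous_of_discreteTopology (f := fun b : Bool => decide (p.2 % 2 = 1) && !b)).comp
        (continuous_apply (p.1, p.2 / 2))
  · rw [monitorable_iff_columns_of_columnwise t ht]
    refine forall_congr' fun m => ?_
    set E : Set ℕ := {n | n % 2 = 1 ∧ α (m, n / 2) = false}
    have hE : {n | (m, n) ∈ {p : ℕ × ℕ |
        (decide (p.2 % 2 = 1) && !α (p.1, p.2 / 2)) = true}} = E := by
      ext n; simp [E]
    have hEc : ¬ {n | (m, n) ∈ {p : ℕ × ℕ |
        (decide (p.2 % 2 = 1) && !α (p.1, p.2 / 2)) = true}ᶜ}.Finite :=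
      Set.infinite_of_forall_exists_gt fun k => ⟨2 * (k + 1), by simp, by omega⟩
    rw [or_iff_left hEc, hE]
    have himage : (fun n => 2 * n + 1) '' {n | α (m, n) = false} = E := by
      ext n
      constructor
      · rintro ⟨k, hk, rfl⟩
        exact ⟨by grind, by simpa [show (2 * k + 1) / 2 = k by omega] using hk⟩
      · rintro ⟨hn, hα⟩
        exact ⟨n / 2, hα, by grind⟩
    rw [← himage]
    exact Set.finite_image_iff fun a _ b _ h => by grind
end

section
/- Let X be a topological space, let (A_n) be a sequence of monitorable subsets of X converging pointwise to a subset B ⊆ X (i.e., for every x ∈ X there is N such that for all n ≥ N, x ∈ A_n ⟺ x ∈ B), and let V be a nonempty open subset of X such that V ⊆ closure(B) and V ⊆ closure(X \ B). Then there is no minimal nonempty open subset of V: every nonempty open set U ⊆ V contains a nonempty open set strictly included in U. -/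
/-- An open set with no nonempty open proper subset lies in the closure of every set it meets. -/
theorem subset_closure_of_minimal_open {X : Type*} [TopologicalSpace X] {U C : Set X}
    (hU : IsOpen U) (hmin : ∀ W : Set X, IsOpen W → W.Nonempty → ¬ W ⊂ U)
    (hC : (U ∩ C).Nonempty) : U ⊆ closure C := by
  obtain ⟨c, hcU, hcC⟩ := hC
  refine fun z hz => mem_closure_iff.2 fun O hO hzO => ⟨c, ?_, hcC⟩
  by_contra hcO
  exact hmin (O ∩ U) (hO.inter hU) ⟨z, hzO, hz⟩
    ⟨Set.inter_subset_right, fun h => hcO (h hcU).1⟩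

/-- If a sequence of monitorable sets converges pointwise to a set `B` which is dense and
codense in a nonempty open set `V`, then `V` contains no minimal nonempty open subset. -/
theorem no_minimal_open_subset {X : Type*} [TopologicalSpace X]
    (A : ℕ → Set X) (hA : ∀ n, Monitorable (A n)) (B : Set X)
    (hconv : ∀ x : X, ∃ N : ℕ, ∀ n ≥ N, (x ∈ A n ↔ x ∈ B))
    (V : Set X) (hV : IsOpen V) (hVne : V.Nonempty)
    (hdense : V ⊆ closure B) (hcodense : V ⊆ closure Bᶜ) :
    ∀ U : Set X, IsOpen U → U.Nonempty → U ⊆ V →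
      ∃ W : Set X, IsOpen W ∧ W.Nonempty ∧ W ⊂ U := by
  intro U hU hUne hUV
  by_contra! hno
  obtain ⟨z, hz⟩ := hUne
  obtain ⟨x, hxU, hxB⟩ := mem_closure_iff.1 (hdense (hUV hz)) U hU hz
  obtain ⟨y, hyU, hyB⟩ := mem_closure_iff.1 (hcodense (hUV hz)) U hU hz
  obtain ⟨N, hN⟩ := hconv x
  obtain ⟨M, hM⟩ := hconv y
  have hx : x ∈ A (max N M) := (hN _ (le_max_left N M)).2 hxB
  have hy : y ∉ A (max N M) := fun h => hyB ((hM _ (le_max_right N M)).1 h)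
  exact hA (max N M) ⟨U, hU, ⟨z, hz⟩,
    subset_closure_of_minimal_open hU hno ⟨x, hxU, hx⟩,
    subset_closure_of_minimal_open hU hno ⟨y, hyU, hy⟩⟩
end

section
/- Let X be a countable, second countable topological space, let H be the union of all minimal nonempty open subsets of X, and let L = interior(X \ H). Then a subset A ⊆ X is monitorable in X if and only if: (i) for every minimal nonempty open set U ⊆ X, either U ⊆ A or A ∩ U = ∅, and (ii) A ∩ L is monitorable in the subspace L (with the subspace topology). -/
/-- A *minimal* nonempty open set: a nonempty open set with no nonempty open set strictly
included in it. -/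
def MinimalOpen {X : Type*} [TopologicalSpace X] (U : Set X) : Prop :=
  IsOpen U ∧ U.Nonempty ∧ ∀ V : Set X, IsOpen V → V.Nonempty → V ⊆ U → V = U

/-- A minimal open set meeting `S` lies in the closure of `S`. -/
theorem MinimalOpen.subset_closure {X : Type*} [TopologicalSpace X] {U S : Set X}
    (hU : MinimalOpen U) (h : (S ∩ U).Nonempty) : U ⊆ closure S := by
  intro x hx
  rw [mem_closure_iff]
  intro V hV hxV
  have hVU : V ∩ U = U := hU.2.2 _ (hV.inter hU.1) ⟨x, hxV, hx⟩ Set.inter_subset_right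
  obtain ⟨y, hyS, hyU⟩ := h
  rw [← hVU] at hyU
  exact ⟨y, hyU.1, hyS⟩

/-- A monitorable set does not split any minimal open set. -/
theorem Monitorable.subset_or_inter_eq_empty {X : Type*} [TopologicalSpace X] {A U : Set X}
    (hA : Monitorable A) (hU : MinimalOpen U) : U ⊆ A ∨ A ∩ U = ∅ := by
  by_contra! h
  obtain ⟨x, hxU, hxA⟩ := Set.not_subset.mp h.1
  exact hA ⟨U, hU.1, hU.2.1, hU.subset_closure h.2, hU.subset_closure ⟨x, hxA, hxU⟩⟩

/-- The trace of `A` on an open subspace `L` is monitorable iff no nonempty open subset of `L`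
witnesses that `A` is both dense and codense there. -/
theorem monitorable_preimage_val_iff {X : Type*} [TopologicalSpace X] {L : Set X}
    (hL : IsOpen L) (A : Set X) :
    Monitorable ((Subtype.val : L → X) ⁻¹' A) ↔
      ¬ ∃ U : Set X, IsOpen U ∧ U.Nonempty ∧ U ⊆ L ∧ U ⊆ closure A ∧ U ⊆ closure Aᶜ := by
  have hcl (S : Set X) :
      closure ((Subtype.val : L → X) ⁻¹' S) = (Subtype.val : L → X) ⁻¹' closure S :=
    (hL.isOpenMap_subtype_val.preimage_closure_eq_closure_preimage continuous_subtype_val S).symm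
  unfold Monitorable
  rw [← Set.preimage_compl, hcl, hcl]
  refine not_congr ⟨?_, ?_⟩
  · rintro ⟨V, hV, hne, h₁, h₂⟩
    exact ⟨Subtype.val '' V, hL.isOpenMap_subtype_val V hV, hne.image _,
      Subtype.coe_image_subset L V, Set.image_subset_iff.mpr h₁, Set.image_subset_iff.mpr h₂⟩
  · rintro ⟨U, hU, ⟨x, hx⟩, hUL, h₁, h₂⟩
    exact ⟨Subtype.val ⁻¹' U, hU.preimage continuous_subtype_val, ⟨⟨x, hUL hx⟩, hx⟩,
      Set.preimage_mono h₁, Set.preimage_mono h₂⟩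

/-- Decomposition of monitorability: with `H` the union of all minimal nonempty open sets
and `L = interior (X \ H)`, a set `A` is monitorable iff it does not split any minimal
open set and its trace on `L` is monitorable in the subspace `L`. -/
theorem monitorable_iff_minimal_and_trace {X : Type*} [TopologicalSpace X] [Countable X]
    [SecondCountableTopology X] (H L : Set X)
    (hH : H = ⋃₀ {U : Set X | MinimalOpen U}) (hL : L = interior Hᶜ) (A : Set X) :
    Monitorable A ↔
      ((∀ U : Set X, MinimalOpen U → U ⊆ A ∨ A ∩ U = ∅) ∧
        Monitorable ((Subtype.val : L → X) ⁻¹' A)) := by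
  have hLo : IsOpen L := hL ▸ isOpen_interior
  rw [monitorable_preimage_val_iff hLo]
  constructor
  · intro hA
    refine ⟨fun U hU => hA.subset_or_inter_eq_empty hU, ?_⟩
    rintro ⟨U, hU, hne, -, h₁, h₂⟩
    exact hA ⟨U, hU, hne, h₁, h₂⟩
  · rintro ⟨hmin, htrace⟩ ⟨W, hW, hne, h₁, h₂⟩
    refine htrace ⟨W, hW, hne, ?_, h₁, h₂⟩
    rw [hL]
    refine interior_maximal (fun x hxW hxH => ?_) hW
    rw [hH] at hxH
    obtain ⟨U, hU, hxU⟩ := hxH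
    rcases hmin U hU with h | h
    · obtain ⟨y, hyU, hyA⟩ := mem_closure_iff.mp (h₂ hxW) U hU.1 hxU
      exact hyA (h hyU)
    · obtain ⟨y, hyU, hyA⟩ := mem_closure_iff.mp (h₁ hxW) U hU.1 hxU
      exact Set.eq_empty_iff_forall_notMem.mp h y ⟨hyA, hyU⟩
end

section
/- Let X be a countable, second countable topological space, let H be the union of all minimal nonempty open subsets of X, and let L = interior(X \ H). Then for every nonempty open set U ⊆ L, the set of points x ∈ U such that the interior of the closure of {x} is empty is infinite. -/
/-- A point whose singleton closure has nonempty interior lies in every nonempty open subset of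
that interior. -/
theorem mem_of_subset_interior_closure_singleton {X : Type*} [TopologicalSpace X] {x : X}
    {V : Set X} (hV : IsOpen V) (hne : V.Nonempty) (hVx : V ⊆ interior (closure ({x} : Set X))) :
    x ∈ V := by
  obtain ⟨v, hv⟩ := hne
  obtain ⟨y, hyV, rfl⟩ := mem_closure_iff.1 (interior_subset (hVx hv)) V hV hv
  exact hyV

theorem mem_interior_closure_singleton {X : Type*} [TopologicalSpace X] {x : X}
    (hx : interior (closure ({x} : Set X)) ≠ ∅) : x ∈ interior (closure ({x} : Set X)) :=
  mem_of_subset_interior_closure_singleton isOpen_interior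
    (Set.nonempty_iff_ne_empty.2 hx) subset_rfl

/-- With `H` the union of all minimal nonempty open sets and `L = interior (X \ H)`,
every nonempty open subset of `L` contains infinitely many points whose singleton
closure has empty interior. -/
theorem infinitely_many_points_with_nowhere_dense_closure {X : Type*} [TopologicalSpace X]
    [Countable X] [SecondCountableTopology X] (H L : Set X)
    (hH : H = ⋃₀ {U : Set X | MinimalOpen U}) (hL : L = interior Hᶜ) :
    ∀ U : Set X, IsOpen U → U.Nonempty → U ⊆ L →
      {x : X | x ∈ U ∧ interior (closure ({x} : Set X)) = ∅}.Infinite := by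
  intro U hU hUne hUL hfin
  set N := {x : X | x ∈ U ∧ interior (closure ({x} : Set X)) = ∅}
  have not_minimal : ∀ W ⊆ U, ¬ MinimalOpen W := by
    intro W hWU hW
    obtain ⟨w, hw⟩ := hW.2.1
    have hwH : w ∈ Hᶜ := interior_subset (hL ▸ hUL (hWU hw))
    exact hwH (hH ▸ Set.mem_sUnion_of_mem hw hW)
  obtain ⟨W, ⟨hW, hWne, hWU⟩, hmin⟩ :=
    (measure fun W : Set X => (W ∩ N).ncard).wf.has_min
      {W | IsOpen W ∧ W.Nonempty ∧ W ⊆ U} ⟨U, hU, hUne, subset_rfl⟩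
  have exists_smaller : ∀ V ⊆ W, IsOpen V → V.Nonempty →
      ∃ V' ⊆ V, IsOpen V' ∧ V'.Nonempty ∧
        ∃ y ∈ V, y ∉ V' ∧ interior (closure ({y} : Set X)) ≠ ∅ := by
    intro V hVW hV hVne
    have h := not_minimal V (hVW.trans hWU)
    simp only [MinimalOpen, not_and, not_forall] at h
    obtain ⟨V', hV', hV'ne, hV'V, hne⟩ := h hV hVne
    obtain ⟨y, hyV, hyV'⟩ := Set.exists_of_ssubset (hV'V.ssubset_of_ne hne)
    refine ⟨V', hV'V, hV', hV'ne, y, hyV, hyV', fun hy => ?_⟩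
    refine hmin V' ⟨hV', hV'ne, (hV'V.trans hVW).trans hWU⟩ ?_
    refine Set.ncard_lt_ncard ?_ (hfin.subset Set.inter_subset_right)
    refine (Set.inter_subset_inter_left N (hV'V.trans hVW)).ssubset_of_ne fun heq => hyV' ?_
    have hyN : y ∈ W ∩ N := ⟨hVW hyV, hWU (hVW hyV), hy⟩
    exact (heq ▸ hyN : y ∈ V' ∩ N).1
  obtain ⟨-, -, -, -, y, hyW, -, hy⟩ := exists_smaller W subset_rfl hW hWne
  obtain ⟨V, hVsub, hV, hVne, z, hz, hzV, hzi⟩ :=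
    exists_smaller (interior (closure {y}) ∩ W) Set.inter_subset_right
      (isOpen_interior.inter hW) ⟨y, mem_interior_closure_singleton hy, hyW⟩
  have hyV : y ∈ V :=
    mem_of_subset_interior_closure_singleton hV hVne (hVsub.trans Set.inter_subset_left)
  have hyz : y ∈ interior (closure {z}) ∩ (interior (closure {y}) ∩ W) :=
    mem_of_subset_interior_closure_singleton
      (isOpen_interior.inter (isOpen_interior.inter hW))
      ⟨z, mem_interior_closure_singleton hzi, hz⟩
      (Set.inter_subset_right.trans Set.inter_subset_left)
  exact hzV (mem_of_subset_interior_closure_singleton (isOpen_interior.inter hV)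
    ⟨y, hyz.1, hyV⟩ Set.inter_subset_left).2
end

section
/- Let X be a countable, second countable topological space, let H be the union of all minimal nonempty open subsets of X, and let L = interior(X \ H). If there is no infinite family of pairwise disjoint nonempty open subsets of L, then there exists N ∈ ℕ such that every family of pairwise disjoint nonempty open subsets of L has cardinality at most N. -/
theorem infinite_range_of_pairwise_disjoint {X : Type*} {A : ℕ → Set X}
    (hne : ∀ n, (A n).Nonempty) (hd : Pairwise (Function.onFun Disjoint A)) :
    (Set.range A).Infinite := by
  refine Set.infinite_range_of_injective fun m n hmn => ?_
  by_contra hne'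
  have h : Disjoint (A m) (A n) := hd hne'
  rw [← hmn, disjoint_self] at h
  exact (hne m).ne_empty h

/-- A nonempty open set without infinite families of pairwise disjoint nonempty open subsets
contains a nonempty open irreducible set. -/
theorem exists_isOpen_isIrreducible_subset {X : Type*} [TopologicalSpace X] {L U : Set X}
    (h : ¬ ∃ 𝒲 : Set (Set X), 𝒲.Infinite ∧
      (∀ U ∈ 𝒲, IsOpen U ∧ U.Nonempty ∧ U ⊆ L) ∧ 𝒲.Pairwise Disjoint)
    (hU : IsOpen U) (hne : U.Nonempty) (hUL : U ⊆ L) :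
    ∃ V ⊆ U, IsOpen V ∧ IsIrreducible V := by
  by_contra hno
  let S := {V : Set X // IsOpen V ∧ V.Nonempty ∧ V ⊆ U}
  have split : ∀ V : S, ∃ A B : S, A.1 ⊆ V.1 ∧ B.1 ⊆ V.1 ∧ Disjoint A.1 B.1 := by
    rintro ⟨V, hVo, hVn, hVU⟩
    have hV : ¬ IsPreirreducible V := fun hV => hno ⟨V, hVU, hVo, hVn, hV⟩
    simp only [IsPreirreducible, not_forall] at hV
    obtain ⟨u, v, hu, hv, hVu, hVv, hVuv⟩ := hV
    refine ⟨⟨V ∩ u, hVo.inter hu, hVu, Set.inter_subset_left.trans hVU⟩,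
      ⟨V ∩ v, hVo.inter hv, hVv, Set.inter_subset_left.trans hVU⟩,
      Set.inter_subset_left, Set.inter_subset_left, ?_⟩
    exact Set.disjoint_left.2 fun x hx hx' => hVuv ⟨x, hx.1, hx.2, hx'.2⟩
  choose A B hA hB hAB using split
  let V : ℕ → S := fun n => B^[n] ⟨U, hU, hne, subset_rfl⟩
  have hV : ∀ n, V (n + 1) = B (V n) := fun n => Function.iterate_succ_apply' _ _ _
  have hanti : Antitone fun n => (V n).1 := antitone_nat_of_succ_le fun n => by
    rw [hV]
    exact hB _
  have hd : Pairwise (Function.onFun Disjoint fun n => (A (V n)).1) := by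
    refine (pairwise_disjoint_on _).2 fun m n hmn => (hAB (V m)).mono_right ?_
    rw [← hV]
    exact (hA _).trans (hanti hmn)
  refine h ⟨_, infinite_range_of_pairwise_disjoint (fun n => (A (V n)).2.2.1) hd, ?_,
    hd.range_pairwise⟩
  rintro _ ⟨n, rfl⟩
  exact ⟨(A (V n)).2.1, (A (V n)).2.2.1, (A (V n)).2.2.2.trans hUL⟩

/-- A maximal family of pairwise disjoint members of a given collection of sets. -/
theorem exists_maximal_pairwise_disjoint_subset {X : Type*} (𝒞 : Set (Set X)) :
    ∃ ℳ : Set (Set X), Maximal (fun 𝒲 => 𝒲 ⊆ 𝒞 ∧ 𝒲.Pairwise Disjoint) ℳ := by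
  refine zorn_subset {𝒲 | 𝒲 ⊆ 𝒞 ∧ 𝒲.Pairwise Disjoint} fun c hc hchain => ?_
  refine ⟨⋃₀ c, ⟨Set.sUnion_subset fun 𝒲 h𝒲 => (hc h𝒲).1, ?_⟩,
    fun 𝒲 h𝒲 => Set.subset_sUnion_of_mem h𝒲⟩
  exact (Set.pairwise_sUnion hchain.directedOn).2 fun 𝒲 h𝒲 => (hc h𝒲).2

/-- With `H` the union of all minimal nonempty open sets and `L = interior (X \ H)`:
if there is no infinite family of pairwise disjoint nonempty open subsets of `L`, then
there is a uniform finite bound on the cardinality of such families. -/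
theorem bounded_disjoint_families {X : Type*} [TopologicalSpace X]
    [Countable X] [SecondCountableTopology X] (H L : Set X)
    (hH : H = ⋃₀ {U : Set X | MinimalOpen U}) (hL : L = interior Hᶜ)
    (h : ¬ ∃ 𝒲 : Set (Set X), 𝒲.Infinite ∧
      (∀ U ∈ 𝒲, IsOpen U ∧ U.Nonempty ∧ U ⊆ L) ∧ 𝒲.Pairwise Disjoint) :
    ∃ N : ℕ, ∀ 𝒲 : Set (Set X),
      (∀ U ∈ 𝒲, IsOpen U ∧ U.Nonempty ∧ U ⊆ L) → 𝒲.Pairwise Disjoint →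
        Cardinal.mk 𝒲 ≤ (N : Cardinal) := by
  obtain ⟨ℳ, ⟨hℳ, hℳd⟩, hmax⟩ :=
    exists_maximal_pairwise_disjoint_subset {U : Set X | IsOpen U ∧ IsIrreducible U ∧ U ⊆ L}
  have hfin : ℳ.Finite := by
    by_contra hinf
    exact h ⟨ℳ, hinf, fun U hU => ⟨(hℳ hU).1, (hℳ hU).2.1.1, (hℳ hU).2.2⟩, hℳd⟩
  refine ⟨ℳ.ncard, fun 𝒲 h𝒲 h𝒲d => ?_⟩
  have meets : ∀ U : 𝒲, ∃ M : ℳ, (M.1 ∩ U.1).Nonempty := by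
    rintro ⟨U, hU⟩
    obtain ⟨hUo, hUn, hUL⟩ := h𝒲 U hU
    obtain ⟨V, hVU, hVo, hVi⟩ := exists_isOpen_isIrreducible_subset h hUo hUn hUL
    by_contra! hno
    have hdisj : ∀ M ∈ ℳ, Disjoint V M := fun M hM =>
      (Set.disjoint_iff_inter_eq_empty.2 (hno ⟨M, hM⟩)).symm.mono_left hVU
    have hVℳ : V ∈ ℳ := by
      refine hmax ⟨Set.insert_subset ⟨hVo, hVi, hVU.trans hUL⟩ hℳ, ?_⟩
        (Set.subset_insert V ℳ) (Set.mem_insert V ℳ)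
      exact hℳd.insert fun M hM _ => ⟨hdisj M hM, (hdisj M hM).symm⟩
    exact hVi.1.ne_empty (disjoint_self.1 (hdisj V hVℳ))
  choose f hf using meets
  have hinj : Function.Injective f := by
    intro U U' hUU'
    by_contra hne
    have hdisj : Disjoint U.1 U'.1 := h𝒲d U.2 U'.2 (Subtype.coe_injective.ne hne)
    obtain ⟨x, -, hx, hx'⟩ := (hℳ (f U).2).2.1.2 U.1 U'.1 (h𝒲 _ U.2).1 (h𝒲 _ U'.2).1
      (hf U) (hUU' ▸ hf U')
    exact Set.disjoint_left.1 hdisj hx hx'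
  rw [Set.cast_ncard hfin]
  exact Cardinal.mk_le_of_injective hinj
end

section
/- Let Y be a countable, second countable, hyperconnected topological space (i.e., any two nonempty open subsets of Y intersect). Then the family of monitorable subsets of Y is a Σ⁰₂ subset of P(Y): there exists a family F : ℕ → Set (P(Y)) of closed subsets of P(Y) (with P(Y) carrying the product topology of 2^Y) such that {A ⊆ Y | A is monitorable} = ⋃_n F(n). -/
open TopologicalSpace in
/-- In a nonempty hyperconnected second countable space, a set is monitorable if and only if some
set of the countable basis is contained in it or in its complement. -/
theorem monitorable_iff_exists_mem_countableBasis {X : Type*} [TopologicalSpace X] [Nonempty X]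
    [SecondCountableTopology X]
    (hX : ∀ U V : Set X, IsOpen U → IsOpen V → U.Nonempty → V.Nonempty → (U ∩ V).Nonempty)
    (A : Set X) : Monitorable A ↔ ∃ U ∈ countableBasis X, U ⊆ A ∨ U ⊆ Aᶜ := by
  constructor
  · intro h
    by_contra! hA
    have key (B : Set X) (hB : ∀ U ∈ countableBasis X, ¬ U ⊆ Bᶜ) : Set.univ ⊆ closure B := by
      intro x _
      rw [(isBasis_countableBasis X).mem_closure_iff]
      intro U hU _
      exact Set.not_disjoint_iff_nonempty_inter.1 fun hd ↦ hB U hU hd.subset_compl_right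
    exact h ⟨Set.univ, isOpen_univ, Set.univ_nonempty, key A fun U hU ↦ (hA U hU).2,
      key Aᶜ fun U hU ↦ by simpa using (hA U hU).1⟩
  · rintro ⟨U, hU, hUA⟩ ⟨V, hVo, hV, hVA, hVA'⟩
    have hUo := isOpen_of_mem_countableBasis hU
    obtain ⟨x, hxU, hxV⟩ := hX U V hUo hVo (nonempty_of_mem_countableBasis hU) hV
    rcases hUA with hUA | hUA
    · obtain ⟨y, hyU, hyA⟩ := mem_closure_iff.1 (hVA' hxV) U hUo hxU
      exact hyA (hUA hyU)
    · obtain ⟨y, hyU, hyA⟩ := mem_closure_iff.1 (hVA hxV) U hUo hxU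
      exact hUA hyU hyA

theorem isClosed_setOf_forall_mem_eq {Y Z : Type*} [TopologicalSpace Z] [T1Space Z] (U : Set Y)
    (z : Z) : IsClosed {f : Y → Z | ∀ y ∈ U, f y = z} := by
  simp only [Set.ofPred_forall]
  exact isClosed_biInter fun y _ ↦ isClosed_singleton.preimage (continuous_apply y)

/-- In a countable, second countable, hyperconnected space `Y`, the family of monitorable
subsets of `Y` is a `Σ⁰₂` subset of `P(Y) = Y → Bool`. -/
theorem monitorable_family_Sigma02_of_hyperconnected {Y : Type*} [TopologicalSpace Y]
    [Countable Y] [SecondCountableTopology Y]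
    (hY : ∀ U V : Set Y, IsOpen U → IsOpen V → U.Nonempty → V.Nonempty →
      (U ∩ V).Nonempty) :
    ∃ F : ℕ → Set (Y → Bool), (∀ n, IsClosed (F n)) ∧
      {f : Y → Bool | Monitorable {y : Y | f y = true}} = ⋃ n, F n := by
  open TopologicalSpace in
  rcases isEmpty_or_nonempty Y with hE | hE
  · refine ⟨fun _ ↦ Set.univ, fun _ ↦ isClosed_univ, ?_⟩
    rw [Set.iUnion_const, Set.eq_univ_iff_forall]
    rintro f ⟨U, -, ⟨y, -⟩, -⟩
    exact hE.elim y
  · obtain ⟨x⟩ := hE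
    obtain ⟨U₀, hU₀, -⟩ := (isBasis_countableBasis Y).exists_subset_of_mem_open
      (Set.mem_univ x) isOpen_univ
    obtain ⟨B, hB⟩ := (countable_countableBasis Y).exists_eq_range ⟨U₀, hU₀⟩
    have : Nonempty Y := ⟨x⟩
    refine ⟨fun n ↦ {f | ∀ y ∈ B n, f y = true} ∪ {f | ∀ y ∈ B n, f y = false},
      fun n ↦ (isClosed_setOf_forall_mem_eq _ _).union (isClosed_setOf_forall_mem_eq _ _), ?_⟩
    ext f
    simp [monitorable_iff_exists_mem_countableBasis hY, hB, Set.subset_def]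
end

section
/- Let X be a countable, second countable topological space. If the family of monitorable subsets of X is not equal to any countable union of closed subsets of P(X) (with the product topology of 2^X), then there exists a continuous function f : (ℕ × ℕ → Bool) → P(X) such that for every α : ℕ × ℕ → Bool, the set f(α) is monitorable in X if and only if for every r ∈ ℕ the set {h ∈ ℕ | α(r,h) = true} is finite. -/
open Set TopologicalSpace Topology

/-- Every nonempty open subset of `V` contains a nonempty open set which is included in `A` or
in its complement. -/
def DenselyDecidedOn {X : Type*} [TopologicalSpace X] (V A : Set X) : Prop :=
  ∀ W ⊆ V, IsOpen W → W.Nonempty → ∃ W' ⊆ W, IsOpen W' ∧ W'.Nonempty ∧ (W' ⊆ A ∨ W' ⊆ Aᶜ)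

/-- A nonempty open set without proper nonempty open subsets. -/
def IsMinimalOpen {X : Type*} [TopologicalSpace X] (m : Set X) : Prop :=
  IsOpen m ∧ m.Nonempty ∧ ∀ W ⊆ m, IsOpen W → W.Nonempty → W = m

section

variable {X : Type*}

theorem isClosed_setOf_decided (W : Set X) :
    IsClosed {f : X → Bool | W ⊆ {x | f x = true} ∨ W ⊆ {x | f x = true}ᶜ} := by
  have key : ∀ b : Bool, IsClosed {f : X → Bool | ∀ x ∈ W, f x = b} := fun b => by
    simp only [ofPred_forall]
    exact isClosed_iInter fun x => isClosed_iInter fun _ =>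
      isClosed_eq (continuous_apply x) continuous_const
  convert (key true).union (key false) using 1
  ext f
  simp [subset_def]

theorem exists_continuous_mem_iff {ι : Type*} {p : ι → Set X}
    (hp : Pairwise fun i j => Disjoint (p i) (p j)) :
    ∃ f : (ι → Bool) → (X → Bool), Continuous f ∧
      ∀ α, {x | f α x = true} = ⋃ i ∈ {i | α i = true}, p i := by
  classical
  refine ⟨fun α x => decide (∃ i, α i = true ∧ x ∈ p i), continuous_pi fun x => ?_, fun α => ?_⟩
  · by_cases hx : ∃ i, x ∈ p i
    · obtain ⟨i, hi⟩ := hx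
      convert continuous_apply (A := fun _ : ι => Bool) i using 2 with α
      rw [Bool.eq_iff_iff, decide_eq_true_iff]
      refine ⟨fun ⟨j, hj, hxj⟩ => ?_, fun h => ⟨i, h, hi⟩⟩
      rwa [hp.eq (a := i) (b := j) (not_disjoint_iff.2 ⟨x, hi, hxj⟩)]
    · convert continuous_const (y := false) using 2 with α
      exact decide_eq_false fun ⟨i, _, hi⟩ => hx ⟨i, hi⟩
  · ext x
    simp

variable [TopologicalSpace X]

theorem exists_isOpen_subset_compl_of_not_subset_closure {U A : Set X} (hU : IsOpen U)
    (h : ¬ U ⊆ closure A) : ∃ W ⊆ U, IsOpen W ∧ W.Nonempty ∧ W ⊆ Aᶜ := by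
  obtain ⟨x, hxU, hx⟩ := not_subset.1 h
  exact ⟨U ∩ (closure A)ᶜ, inter_subset_left, hU.inter isClosed_closure.isOpen_compl,
    ⟨x, hxU, hx⟩, fun y hy hyA => hy.2 (subset_closure hyA)⟩

theorem monitorable_iff_denselyDecidedOn_univ {A : Set X} :
    Monitorable A ↔ DenselyDecidedOn univ A := by
  constructor
  · intro h W _ hW hne
    by_cases h1 : W ⊆ closure A
    · have h2 : ¬ W ⊆ closure Aᶜ := fun h2 => h ⟨W, hW, hne, h1, h2⟩
      obtain ⟨W', hs, ho, hn, hd⟩ := exists_isOpen_subset_compl_of_not_subset_closure hW h2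
      exact ⟨W', hs, ho, hn, Or.inl (by simpa using hd)⟩
    · obtain ⟨W', hs, ho, hn, hd⟩ := exists_isOpen_subset_compl_of_not_subset_closure hW h1
      exact ⟨W', hs, ho, hn, Or.inr hd⟩
  · rintro h ⟨U, hU, hne, h1, h2⟩
    obtain ⟨W, hs, ho, ⟨x, hx⟩, hd | hd⟩ := h U (subset_univ _) hU hne
    · obtain ⟨y, hy, hyA⟩ := mem_closure_iff.1 (h2 (hs hx)) W ho hx
      exact hyA (hd hy)
    · obtain ⟨y, hy, hyA⟩ := mem_closure_iff.1 (h1 (hs hx)) W ho hx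
      exact hd hy hyA

theorem DenselyDecidedOn.mono {V V' A : Set X} (h : DenselyDecidedOn V A) (hV : V' ⊆ V) :
    DenselyDecidedOn V' A :=
  fun W hW => h W (hW.trans hV)

theorem DenselyDecidedOn.of_union {V₁ V₂ V A : Set X} (h₁ : DenselyDecidedOn V₁ A)
    (h₂ : DenselyDecidedOn V₂ A) (ho₁ : IsOpen V₁) (ho₂ : IsOpen V₂)
    (hV : V ⊆ closure (V₁ ∪ V₂)) : DenselyDecidedOn V A := by
  rintro W hW ho ⟨x, hx⟩
  obtain ⟨y, hyW, hy | hy⟩ := mem_closure_iff.1 (hV (hW hx)) W ho hx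
  · obtain ⟨W', hs, h'⟩ := h₁ (W ∩ V₁) inter_subset_right (ho.inter ho₁) ⟨y, hyW, hy⟩
    exact ⟨W', hs.trans inter_subset_left, h'⟩
  · obtain ⟨W', hs, h'⟩ := h₂ (W ∩ V₂) inter_subset_right (ho.inter ho₂) ⟨y, hyW, hy⟩
    exact ⟨W', hs.trans inter_subset_left, h'⟩

/-- The sets densely decided on `V` form a `Σ⁰₂` family. -/
def SigmaTwoOn (V : Set X) : Prop :=
  IsGδ {f : X → Bool | DenselyDecidedOn V {x | f x = true}}ᶜ

theorem SigmaTwoOn.of_union {V₁ V₂ V : Set X} (h₁ : SigmaTwoOn V₁) (h₂ : SigmaTwoOn V₂)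
    (ho₁ : IsOpen V₁) (ho₂ : IsOpen V₂) (hs₁ : V₁ ⊆ V) (hs₂ : V₂ ⊆ V)
    (hV : V ⊆ closure (V₁ ∪ V₂)) : SigmaTwoOn V := by
  have := IsGδ.union h₁ h₂
  rw [← compl_inter] at this
  unfold SigmaTwoOn
  convert this using 2
  ext f
  exact ⟨fun h => ⟨h.mono hs₁, h.mono hs₂⟩, fun h => h.1.of_union h.2 ho₁ ho₂ hV⟩

theorem SigmaTwoOn.of_subset_closure {V₁ V : Set X} (h₁ : SigmaTwoOn V₁)
    (h₂ : SigmaTwoOn (V \ closure V₁)) (ho₁ : IsOpen V₁) (ho : IsOpen V) (hs : V₁ ⊆ V) :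
    SigmaTwoOn V := by
  refine h₁.of_union h₂ ho₁ (ho.sdiff isClosed_closure) hs sdiff_subset fun x hx => ?_
  by_cases hc : x ∈ closure V₁
  · exact closure_mono subset_union_left hc
  · exact subset_closure (Or.inr ⟨hx, hc⟩)

theorem SigmaTwoOn.of_irreducible [SecondCountableTopology X] {V : Set X}
    (hV : IsOpen V) (hne : V.Nonempty)
    (hirr : ∀ W₁ ⊆ V, ∀ W₂ ⊆ V, IsOpen W₁ → IsOpen W₂ → W₁.Nonempty → W₂.Nonempty →
      (W₁ ∩ W₂).Nonempty) : SigmaTwoOn V := by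
  have hG : IsGδ (⋂ W ∈ {W ∈ countableBasis X | W ⊆ V},
      {f : X → Bool | W ⊆ {x | f x = true} ∨ W ⊆ {x | f x = true}ᶜ}ᶜ) :=
    IsGδ.biInter ((countable_countableBasis X).mono (sep_subset _ _))
      fun W _ => (isClosed_setOf_decided W).isOpen_compl.isGδ
  unfold SigmaTwoOn
  convert hG using 1
  rw [← compl_inj_iff, compl_compl]
  ext f
  simp only [compl_iInter, compl_compl, mem_iUnion, mem_ofPred_eq, exists_prop]
  constructor
  · intro h
    obtain ⟨W, hs, ho, ⟨x, hx⟩, hd⟩ := h V Subset.rfl hV hne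
    obtain ⟨B, hB, -, hBW⟩ := (isBasis_countableBasis X).exists_subset_of_mem_open hx ho
    exact ⟨B, ⟨hB, hBW.trans hs⟩, hd.imp hBW.trans hBW.trans⟩
  · rintro ⟨B, ⟨hB, hBV⟩, hd⟩ W hW ho hn
    have hBo := isOpen_of_mem_countableBasis hB
    exact ⟨B ∩ W, inter_subset_right, hBo.inter ho,
      hirr B hBV W hW hBo ho (nonempty_of_mem_countableBasis hB) hn,
      hd.imp inter_subset_left.trans inter_subset_left.trans⟩

theorem sigmaTwoOn_sUnion_isMinimalOpen : SigmaTwoOn (⋃₀ {m : Set X | IsMinimalOpen m}) := by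
  have hC : IsClosed (⋂ m ∈ {m : Set X | IsMinimalOpen m},
      {f : X → Bool | m ⊆ {x | f x = true} ∨ m ⊆ {x | f x = true}ᶜ}) :=
    isClosed_biInter fun m _ => isClosed_setOf_decided m
  unfold SigmaTwoOn
  convert hC.isOpen_compl.isGδ using 2
  ext f
  simp only [mem_iInter, mem_ofPred_eq]
  constructor
  · intro h m hm
    obtain ⟨W, hs, ho, hn, hd⟩ := h m (subset_sUnion_of_mem hm) hm.1 hm.2.1
    rwa [hm.2.2 W hs ho hn] at hd
  · rintro h W hW ho ⟨x, hx⟩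
    obtain ⟨m, hm, hxm⟩ := hW hx
    have := hm.2.2 (W ∩ m) inter_subset_right (ho.inter hm.1) ⟨x, hx, hxm⟩
    exact ⟨m, this ▸ inter_subset_left, hm.1, hm.2.1, h m hm⟩

theorem exists_disjoint_of_not_sigmaTwoOn [SecondCountableTopology X] {V : Set X}
    (hV : IsOpen V) (h : ¬ SigmaTwoOn V) :
    ∃ P ⊆ V, ∃ Q ⊆ V, IsOpen P ∧ ¬ SigmaTwoOn P ∧ IsOpen Q ∧ Q.Nonempty ∧ Disjoint P Q := by
  have hne : V.Nonempty := by
    rw [nonempty_iff_ne_empty]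
    rintro rfl
    refine h ?_
    have : {f : X → Bool | DenselyDecidedOn ∅ {x | f x = true}} = univ :=
      eq_univ_of_forall fun f W hW _ hn => absurd (subset_empty_iff.1 hW) hn.ne_empty
    simp [SigmaTwoOn, this]
  have : ∃ W₁ ⊆ V, ∃ W₂ ⊆ V, IsOpen W₁ ∧ IsOpen W₂ ∧ W₁.Nonempty ∧ W₂.Nonempty ∧
      Disjoint W₁ W₂ := by
    by_contra! hcon
    exact h (.of_irreducible hV hne fun W₁ h₁ W₂ h₂ o₁ o₂ n₁ n₂ =>
      not_disjoint_iff_nonempty_inter.1 (hcon W₁ h₁ W₂ h₂ o₁ o₂ n₁ n₂))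
  obtain ⟨W₁, h₁, W₂, h₂, o₁, o₂, n₁, ⟨x, hx⟩, hd⟩ := this
  have hoD : IsOpen (V \ closure W₁) := hV.sdiff isClosed_closure
  have hdis : Disjoint W₁ (V \ closure W₁) :=
    disjoint_sdiff_right.mono_left subset_closure
  by_cases hg : SigmaTwoOn W₁
  · exact ⟨_, sdiff_subset, W₁, h₁, hoD, fun h' => h (hg.of_subset_closure h' o₁ hV h₁), o₁, n₁,
      hdis.symm⟩
  · exact ⟨W₁, h₁, _, sdiff_subset, o₁, hg, hoD,
      ⟨x, h₂ hx, fun hc => (hd.symm.closure_right o₂).le_bot ⟨hx, hc⟩⟩, hdis⟩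

theorem exists_seq_disjoint_of_not_sigmaTwoOn [SecondCountableTopology X] {V : Set X}
    (hV : IsOpen V) (h : ¬ SigmaTwoOn V) :
    ∃ U : ℕ → Set X, (∀ r, IsOpen (U r) ∧ (U r).Nonempty ∧ U r ⊆ V) ∧
      Pairwise fun r s => Disjoint (U r) (U s) := by
  choose! P hPs Q hQs hPo hPn hQo hQn hd using
    fun (V : Set X) (hV : IsOpen V ∧ ¬ SigmaTwoOn V) =>
      exists_disjoint_of_not_sigmaTwoOn hV.1 hV.2
  have hT : ∀ n, IsOpen (P^[n] V) ∧ ¬ SigmaTwoOn (P^[n] V) := fun n => by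
    induction n with
    | zero => exact ⟨hV, h⟩
    | succ n ih =>
      rw [Function.iterate_succ_apply']
      exact ⟨hPo _ ih, hPn _ ih⟩
  have hanti : Antitone fun n => P^[n] V := antitone_nat_of_succ_le fun n => by
    rw [Function.iterate_succ_apply']
    exact hPs _ (hT n)
  refine ⟨fun n => Q (P^[n] V), fun n => ⟨hQo _ (hT n), hQn _ (hT n),
    (hQs _ (hT n)).trans (hanti (Nat.zero_le n))⟩, ?_⟩
  refine (pairwise_disjoint_on _).2 fun m n hmn => ?_
  refine (hd _ (hT m)).symm.mono_right ((hQs _ (hT n)).trans ?_)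
  rw [← Function.iterate_succ_apply' P]
  exact hanti hmn

theorem mem_of_subset_closure_singleton {W : Set X} {y : X} (hW : IsOpen W) (hne : W.Nonempty)
    (h : W ⊆ closure {y}) : y ∈ W := by
  obtain ⟨x, hx⟩ := hne
  obtain ⟨_, hz, rfl⟩ := mem_closure_iff.1 (h hx) W hW hx
  exact hz

theorem exists_isNowhereDense_singleton {V : Set X} (hV : IsOpen V) (hne : V.Nonempty)
    (hmin : ∀ m ⊆ V, ¬ IsMinimalOpen m) : ∃ x ∈ V, IsNowhereDense {x} := by
  by_contra! hcon
  have hint : ∀ y ∈ V, y ∈ interior (closure {y}) := fun y hy =>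
    mem_of_subset_closure_singleton isOpen_interior
      (nonempty_iff_ne_empty.2 (hcon y hy)) interior_subset
  obtain ⟨y, hy⟩ := hne
  have hWV := hmin (interior (closure {y}) ∩ V) inter_subset_right
  simp only [IsMinimalOpen, not_and, not_forall] at hWV
  obtain ⟨W, hs, ho, hn, hW⟩ := hWV (isOpen_interior.inter hV) ⟨y, hint y hy, hy⟩
  obtain ⟨x, ⟨hxi, hxV⟩, hxW⟩ := not_subset.1 fun h => hW (hs.antisymm h)
  have hyW : y ∈ W := mem_of_subset_closure_singleton ho hn
    fun z hz => interior_subset (hs hz).1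
  have hyx : y ∈ interior (closure {x}) := by
    obtain ⟨_, hz, rfl⟩ := mem_closure_iff.1 (interior_subset hxi) _ isOpen_interior (hint x hxV)
    exact hz
  obtain ⟨_, hz, rfl⟩ := mem_closure_iff.1 (interior_subset hyx) W ho hyW
  exact hxW hz

theorem isNowhereDense_biUnion_of_finite {ι : Type*} {s : Set ι} (hs : s.Finite)
    {A : ι → Set X} (h : ∀ i ∈ s, IsNowhereDense (A i)) : IsNowhereDense (⋃ i ∈ s, A i) := by
  induction s, hs using Set.Finite.induction_on with
  | empty => simp
  | insert _ _ ih =>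
    rw [biUnion_insert]
    rw [IsNowhereDense, closure_union, interior_union_isClosed_of_interior_empty isClosed_closure]
    · exact h _ (mem_insert _ _)
    · exact ih fun i hi => h i (mem_insert_of_mem _ hi)

theorem exists_isOpen_disjoint_of_isNowhereDense {A W : Set X} (hA : IsNowhereDense A)
    (hW : IsOpen W) (hne : W.Nonempty) : ∃ W' ⊆ W, IsOpen W' ∧ W'.Nonempty ∧ W' ⊆ Aᶜ :=
  exists_isOpen_subset_compl_of_not_subset_closure hW fun h =>
    hne.ne_empty (subset_empty_iff.1 (hA ▸ hW.subset_interior_iff.2 h))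

/-- Successive choice of new points from sets which no finite set of chosen points exhausts. -/
theorem exists_injective_seq {α : Type*} {P : ℕ → α → Prop}
    (h : ∀ n (s : Finset α), (∀ x ∈ s, ∃ m, P m x) → ∃ y, P n y ∧ y ∉ s) :
    ∃ z : ℕ → α, Function.Injective z ∧ ∀ n, P n (z n) := by
  classical
  have : Nonempty α := ⟨(h 0 ∅ (by simp)).choose⟩
  choose! g hg hgs using h
  let F : ℕ → Finset α := fun n => Nat.rec ∅ (fun n s => insert (g n s) s) n
  have hsucc : ∀ n, F (n + 1) = insert (g n (F n)) (F n) := fun n => rfl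
  have hF : ∀ n, ∀ x ∈ F n, ∃ m, P m x := fun n => by
    induction n with
    | zero => simp [F]
    | succ n ih =>
      intro x hx
      rw [hsucc, Finset.mem_insert] at hx
      rcases hx with rfl | hx
      · exact ⟨n, hg n _ ih⟩
      · exact ih x hx
  have hmono : Monotone F := monotone_nat_of_le_succ fun n => by
    rw [hsucc]
    exact Finset.subset_insert _ _
  have hne : ∀ m n, m < n → g m (F m) ≠ g n (F n) := fun m n hmn heq =>
    hgs n (F n) (hF n) (heq ▸ hmono (Nat.succ_le_of_lt hmn) (by simp [hsucc]))
  refine ⟨fun n => g n (F n), fun m n heq => ?_, fun n => hg n _ (hF n)⟩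
  by_contra hmn
  rcases lt_or_gt_of_ne hmn with hlt | hlt
  · exact hne m n hlt heq
  · exact hne n m hlt heq.symm

theorem exists_disjoint_seq_isNowhereDense_dense [SecondCountableTopology X] {U : Set X}
    (hU : IsOpen U) (hne : U.Nonempty) (hmin : ∀ m ⊆ U, ¬ IsMinimalOpen m) :
    ∃ p : ℕ → Set X, (Pairwise fun h k => Disjoint (p h) (p k)) ∧
      (∀ h, p h ⊆ U ∧ IsNowhereDense (p h)) ∧
      ∀ S : Set ℕ, S.Infinite → U ⊆ closure (⋃ h ∈ S, p h) := by
  have hT : {B ∈ countableBasis X | B ⊆ U}.Nonempty := by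
    obtain ⟨x, hx⟩ := hne
    obtain ⟨B, hB, -, hBU⟩ := (isBasis_countableBasis X).exists_subset_of_mem_open hx hU
    exact ⟨B, hB, hBU⟩
  obtain ⟨B, hB⟩ := ((countable_countableBasis X).mono (sep_subset _ _)).exists_eq_range hT
  have hBm : ∀ i, B i ∈ countableBasis X ∧ B i ⊆ U := fun i => by
    have : B i ∈ {B ∈ countableBasis X | B ⊆ U} := hB ▸ mem_range_self i
    exact this
  obtain ⟨z, hz, hzB⟩ := exists_injective_seq
    (P := fun n x => x ∈ B n.unpair.2 ∧ IsNowhereDense {x}) (fun n s hs => by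
      have hnd : IsNowhereDense (s : Set X) := by
        rw [← biUnion_of_singleton (s : Set X)]
        exact isNowhereDense_biUnion_of_finite s.finite_toSet fun x hx => (hs x hx).choose_spec.2
      obtain ⟨W, hW, ho, hn, hWs⟩ := exists_isOpen_disjoint_of_isNowhereDense hnd
        (isOpen_of_mem_countableBasis (hBm n.unpair.2).1)
        (nonempty_of_mem_countableBasis (hBm n.unpair.2).1)
      obtain ⟨x, hx, hxn⟩ := exists_isNowhereDense_singleton ho hn
        fun m hm => hmin m ((hm.trans hW).trans (hBm _).2)
      exact ⟨x, ⟨hW hx, hxn⟩, hWs hx⟩)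
  refine ⟨fun h => ⋃ i ∈ Iic h, {z (Nat.pair h i)}, fun h k hhk => ?_, fun h => ⟨?_, ?_⟩, ?_⟩
  · refine disjoint_left.2 fun x hx hx' => hhk ?_
    simp only [mem_iUnion, mem_singleton_iff, exists_prop] at hx hx'
    obtain ⟨i, -, rfl⟩ := hx
    obtain ⟨j, -, hj⟩ := hx'
    exact (Nat.pair_eq_pair.1 (hz hj)).1
  · refine iUnion₂_subset fun i _ => singleton_subset_iff.2 ?_
    exact (hBm _).2 (hzB _).1
  · exact isNowhereDense_biUnion_of_finite (finite_Iic h) fun i _ => (hzB _).2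
  · intro S hS x hx
    refine mem_closure_iff.2 fun W hW hxW => ?_
    obtain ⟨C, hC, -, hCW⟩ := (isBasis_countableBasis X).exists_subset_of_mem_open
      (show x ∈ W ∩ U from ⟨hxW, hx⟩) (hW.inter hU)
    obtain ⟨i, rfl⟩ : C ∈ range B := hB ▸ ⟨hC, hCW.trans inter_subset_right⟩
    obtain ⟨h, hh, hih⟩ := hS.exists_gt i
    refine ⟨z (Nat.pair h i), (hCW ?_).1, ?_⟩
    · simpa using (hzB (Nat.pair h i)).1
    · exact mem_iUnion₂.2 ⟨h, hh, mem_iUnion₂.2 ⟨i, hih.le, rfl⟩⟩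

theorem exists_disjoint_seq_isNowhereDense_dense_codense [SecondCountableTopology X] {U : Set X}
    (hU : IsOpen U) (hne : U.Nonempty) (hmin : ∀ m ⊆ U, ¬ IsMinimalOpen m) :
    ∃ p : ℕ → Set X, (Pairwise fun h k => Disjoint (p h) (p k)) ∧
      (∀ h, p h ⊆ U ∧ IsNowhereDense (p h)) ∧
      (∀ S : Set ℕ, S.Infinite → U ⊆ closure (⋃ h ∈ S, p h)) ∧
      U ⊆ closure (⋃ h, p h)ᶜ := by
  obtain ⟨p, hd, hp, hS⟩ := exists_disjoint_seq_isNowhereDense_dense hU hne hmin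
  have hinj : Function.Injective fun n : ℕ => 2 * n := fun a b h => by simpa using h
  refine ⟨fun h => p (2 * h), fun h k hhk => hd (hinj.ne hhk), fun h => hp _, fun S hSi => ?_, ?_⟩
  · simpa using hS _ (hSi.image hinj.injOn)
  · have hodd : (range fun n : ℕ => 2 * n + 1).Infinite :=
      infinite_range_of_injective fun a b h => by simpa using h
    refine (hS _ hodd).trans (closure_mono fun x hx hx' => ?_)
    simp only [mem_iUnion, mem_range, exists_prop] at hx hx'
    obtain ⟨_, ⟨k, rfl⟩, hk⟩ := hx
    obtain ⟨h, hh⟩ := hx'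
    exact disjoint_left.1 (hd (show 2 * k + 1 ≠ 2 * h by omega)) hk hh

end

/-- If the family of monitorable subsets of a countable, second countable space `X` is
not `Σ⁰₂` in `P(X) = X → Bool`, then it is `Π⁰₃`-hard: the `Π⁰₃`-complete set
`{α | ∀ r, α (r, h) = true for only finitely many h}` Wadge reduces to it. -/
theorem monitorable_not_Sigma02_Pi03_hard {X : Type*} [TopologicalSpace X] [Countable X]
    [SecondCountableTopology X]
    (h : ¬ ∃ F : ℕ → Set (X → Bool), (∀ n, IsClosed (F n)) ∧
      {f : X → Bool | Monitorable {x : X | f x = true}} = ⋃ n, F n) :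
    ∃ f : (ℕ × ℕ → Bool) → (X → Bool), Continuous f ∧
      ∀ α : ℕ × ℕ → Bool,
        (Monitorable {x : X | f α x = true} ↔
          ∀ r : ℕ, {h : ℕ | α (r, h) = true}.Finite) := by
  set M : Set X := ⋃₀ {m : Set X | IsMinimalOpen m}
  have hMo : IsOpen M := isOpen_sUnion fun m hm => hm.1
  have hV : ¬ SigmaTwoOn (univ \ closure M) := fun hV => by
    have hG : SigmaTwoOn (univ : Set X) :=
      sigmaTwoOn_sUnion_isMinimalOpen.of_subset_closure hV hMo isOpen_univ (subset_univ _)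
    obtain ⟨G, hGo, hG⟩ := isGδ_iff_eq_iInter_nat.1 hG
    refine h ⟨fun n => (G n)ᶜ, fun n => (hGo n).isClosed_compl, ?_⟩
    rw [← compl_iInter, ← hG, compl_compl]
    simp only [monitorable_iff_denselyDecidedOn_univ]
  obtain ⟨U, hU, hUd⟩ := exists_seq_disjoint_of_not_sigmaTwoOn
    (isOpen_univ.sdiff isClosed_closure) hV
  have hmin : ∀ r, ∀ m ⊆ U r, ¬ IsMinimalOpen m := fun r m hmU hm => by
    obtain ⟨x, hx⟩ := hm.2.1
    exact ((hU r).2.2 (hmU hx)).2 (subset_closure ⟨m, hm, hx⟩)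
  choose p hpd hp hpS hpc using fun r =>
    exists_disjoint_seq_isNowhereDense_dense_codense (hU r).1 (hU r).2.1 (hmin r)
  have hpU : ∀ r s k x, x ∈ U r → x ∈ p s k → s = r := fun r s k x hx hxp =>
    hUd.eq (not_disjoint_iff.2 ⟨x, (hp s k).1 hxp, hx⟩)
  obtain ⟨f, hf, hfα⟩ := exists_continuous_mem_iff (p := fun i : ℕ × ℕ => p i.1 i.2) (by
    rintro ⟨r, h⟩ ⟨s, k⟩ hne
    by_cases hrs : r = s
    · subst hrs
      exact hpd r fun hhk => hne (congrArg (Prod.mk r) hhk)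
    · exact (hUd hrs).mono (hp r h).1 (hp s k).1)
  refine ⟨f, hf, fun α => ?_⟩
  rw [hfα]
  constructor
  · intro hmon r
    by_contra hinf
    refine hmon ⟨U r, (hU r).1, (hU r).2.1, (hpS r _ hinf).trans (closure_mono ?_), ?_⟩
    · exact iUnion₂_subset fun k hk x hx => mem_iUnion₂.2 ⟨(r, k), hk, hx⟩
    · intro x hx
      refine mem_closure_iff.2 fun W hW hxW => ?_
      obtain ⟨y, ⟨hyW, hyU⟩, hy⟩ :=
        mem_closure_iff.1 (hpc r hx) (W ∩ U r) (hW.inter (hU r).1) ⟨hxW, hx⟩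
      refine ⟨y, hyW, fun hyA => ?_⟩
      obtain ⟨⟨s, k⟩, -, hyp⟩ := mem_iUnion₂.1 hyA
      obtain rfl := hpU r s k y hyU hyp
      exact hy (mem_iUnion.2 ⟨k, hyp⟩)
  · intro hfin
    refine monitorable_iff_denselyDecidedOn_univ.2 fun W _ hW hne => ?_
    by_cases hWU : ∃ r, (W ∩ U r).Nonempty
    · obtain ⟨r, hr⟩ := hWU
      obtain ⟨W', hs, ho, hn, hd⟩ := exists_isOpen_disjoint_of_isNowhereDense
        (isNowhereDense_biUnion_of_finite (hfin r) fun k _ => (hp r k).2)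
        (hW.inter (hU r).1) hr
      refine ⟨W', hs.trans inter_subset_left, ho, hn, Or.inr fun x hx hxA => hd hx ?_⟩
      obtain ⟨⟨s, k⟩, hk, hxp⟩ := mem_iUnion₂.1 hxA
      obtain rfl := hpU r s k x (hs hx).2 hxp
      exact mem_iUnion₂.2 ⟨k, hk, hxp⟩
    · refine ⟨W, Subset.rfl, hW, hne, Or.inr fun x hx hxA => hWU ?_⟩
      obtain ⟨⟨s, k⟩, -, hxp⟩ := mem_iUnion₂.1 hxA
      exact ⟨s, x, hx, (hp s k).1 hxp⟩
end

section
/- Let X be a countably infinite set and E a nonempty countable set. For R ⊆ X × E × X let T_R be the topology on X generated by the basis consisting of the sets U_F^R for finite F ⊆ E^{<ω}, where q₀ ∈ U_F^R iff for every s ∈ F there exist q₁, …, q_{length(s)} ∈ X with (q_h, s(h), q_{h+1}) ∈ R for all h < length(s). Then the set { R ∈ P(X × E × X) | the topology T_R is hyperconnected } is a dense Gδ subset of P(X × E × X) (with the product topology of 2^(X×E×X)); consequently, the set of R such that the family of monitorable subsets of (X, T_R) is a countable union of closed subsets of P(X) is comeagre in P(X × E × X). -/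
open Topology

/-- The basic open set `U_F^R` determined by a transition relation `R ⊆ X × E × X`
(coded as `R : X × E × X → Bool`) and a finite set `F` of finite words over `E`:
the states from which every word in `F` labels some finite run of `R`. -/
def UF {X E : Type*} (R : X × E × X → Bool) (F : Finset (List E)) : Set X :=
  {q₀ : X | ∀ s ∈ F, ∃ q : ℕ → X, q 0 = q₀ ∧
    ∀ h : Fin s.length, R (q h.val, s.get h, q (h.val + 1)) = true}

/-- The topology `T_R` on `X` generated by the basis `{U_F^R | F ⊆ E^{<ω} finite}`. -/
def trel {X E : Type*} (R : X × E × X → Bool) : TopologicalSpace X :=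
  TopologicalSpace.generateFrom {U : Set X | ∃ F : Finset (List E), U = UF R F}

theorem UF_union {X E : Type*} [DecidableEq E] (R : X × E × X → Bool) (F G : Finset (List E)) :
    UF R (F ∪ G) = UF R F ∩ UF R G := by
  ext x
  simp only [UF, Set.mem_inter_iff, Set.mem_ofPred_eq, Finset.mem_union, or_imp, forall_and]

theorem isTopologicalBasis_UF {X E : Type*} (R : X × E × X → Bool) :
    @TopologicalSpace.IsTopologicalBasis X (trel R) {U | ∃ F : Finset (List E), U = UF R F} := by
  classical
  let := trel R
  refine ⟨?_, ?_, rfl⟩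
  · rintro _ ⟨F, rfl⟩ _ ⟨G, rfl⟩ x hx
    exact ⟨_, ⟨F ∪ G, rfl⟩, by rwa [UF_union], (UF_union R F G).subset⟩
  · exact Set.eq_univ_of_forall fun x ↦ ⟨_, ⟨∅, rfl⟩, by simp [UF]⟩

theorem isOpen_UF {X E : Type*} (R : X × E × X → Bool) (F : Finset (List E)) :
    IsOpen[trel R] (UF R F) :=
  TopologicalSpace.isOpen_generateFrom_of_mem ⟨F, rfl⟩

theorem exists_UF_subset {X E : Type*} {R : X × E × X → Bool} {U : Set X}
    (hU : IsOpen[trel R] U) (hne : U.Nonempty) :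
    ∃ F : Finset (List E), (UF R F).Nonempty ∧ UF R F ⊆ U := by
  let := trel R
  obtain ⟨x, hx⟩ := hne
  obtain ⟨_, ⟨F, rfl⟩, hxF, hF⟩ := (isTopologicalBasis_UF R).exists_subset_of_mem_open hx hU
  exact ⟨F, ⟨x, hxF⟩, hF⟩

theorem isOpen_setOf_UF_nonempty {X E : Type*} (F : Finset (List E)) :
    IsOpen {R : X × E × X → Bool | (UF R F).Nonempty} := by
  have h : {R : X × E × X → Bool | (UF R F).Nonempty} =
      ⋃ x : X, ⋂ s ∈ F, ⋃ q : ℕ → X, ⋃ _ : q 0 = x, ⋂ h : Fin s.length,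
        {R | R (q h.val, s.get h, q (h.val + 1)) = true} := by
    ext R
    simp [UF, Set.Nonempty]
  rw [h]
  refine isOpen_iUnion fun x ↦ isOpen_biInter_finset fun s _ ↦ isOpen_iUnion fun q ↦
    isOpen_iUnion fun _ ↦ isOpen_iInter_of_finite fun h ↦ ?_
  exact (isOpen_discrete ({true} : Set Bool)).preimage
    (continuous_apply (A := fun _ : X × E × X ↦ Bool) (q h.val, s.get h, q (h.val + 1)))

/-- Hyperconnectedness of `T_R` can be tested on the basic open sets. -/
theorem hyperconnected_iff_UF {X E : Type*} [DecidableEq E] (R : X × E × X → Bool) :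
    (∀ U V : Set X, IsOpen[trel R] U → IsOpen[trel R] V → U.Nonempty → V.Nonempty →
      (U ∩ V).Nonempty) ↔
    ∀ F G : Finset (List E), (UF R F).Nonempty → (UF R G).Nonempty →
      (UF R (F ∪ G)).Nonempty := by
  constructor
  · intro h F G hF hG
    rw [UF_union]
    exact h _ _ (isOpen_UF R F) (isOpen_UF R G) hF hG
  · intro h U V hU hV hUne hVne
    obtain ⟨F, hF, hFU⟩ := exists_UF_subset hU hUne
    obtain ⟨G, hG, hGV⟩ := exists_UF_subset hV hVne
    have hFG := h F G hF hG
    rw [UF_union] at hFG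
    exact hFG.mono (Set.inter_subset_inter hFU hGV)

theorem isGδ_setOf_hyperconnected {X E : Type*} [Countable X] [Countable E] :
    IsGδ {R : X × E × X → Bool | ∀ U V : Set X,
      IsOpen[trel R] U → IsOpen[trel R] V → U.Nonempty → V.Nonempty → (U ∩ V).Nonempty} := by
  classical
  simp only [hyperconnected_iff_UF]
  rw [Set.ofPred_forall]
  refine .iInter fun F ↦ ?_
  rw [Set.ofPred_forall]
  refine .iInter fun G ↦ ?_
  simp only [imp_iff_not_or, Set.ofPred_or]
  exact (isOpen_setOf_UF_nonempty F).isClosed_compl.isGδ.union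
    ((isOpen_setOf_UF_nonempty G).isClosed_compl.isGδ.union
      (isOpen_setOf_UF_nonempty (F ∪ G)).isGδ)

theorem dense_setOf_hyperconnected {X E : Type*} [Infinite X] :
    Dense {R : X × E × X → Bool | ∀ U V : Set X,
      IsOpen[trel R] U → IsOpen[trel R] V → U.Nonempty → V.Nonempty → (U ∩ V).Nonempty} := by
  classical
  rw [dense_iff_inter_open]
  rintro O hO ⟨R₀, hR₀⟩
  obtain ⟨I, u, hu, hIu⟩ := isOpen_pi_iff.1 hO R₀ hR₀
  obtain ⟨x, hx⟩ := Infinite.exists_notMem_finset (I.image Prod.fst)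
  have hmem (F : Finset (List E)) :
      x ∈ UF (fun p : X × E × X ↦ if p.1 = x then true else R₀ p) F :=
    fun s _ ↦ ⟨fun _ ↦ x, rfl, fun _ ↦ by simp⟩
  refine ⟨fun p ↦ if p.1 = x then true else R₀ p, hIu fun p hp ↦ ?_, ?_⟩
  · have hpx : p.1 ≠ x := fun h ↦ hx (Finset.mem_image.2 ⟨p, hp, h⟩)
    simpa [hpx] using (hu p hp).2
  · exact (hyperconnected_iff_UF _).2 fun F G _ _ ↦ ⟨x, hmem _⟩

/-- In a nonempty hyperconnected space, a set is monitorable iff it or its complement has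
nonempty interior. -/
theorem monitorable_iff_of_hyperconnected {X : Type*} [TopologicalSpace X] [Nonempty X]
    (h : ∀ U V : Set X, IsOpen U → IsOpen V → U.Nonempty → V.Nonempty → (U ∩ V).Nonempty)
    (A : Set X) :
    Monitorable A ↔ (interior A).Nonempty ∨ (interior Aᶜ).Nonempty := by
  constructor
  · intro hA
    by_contra! hne
    refine hA ⟨Set.univ, isOpen_univ, Set.univ_nonempty, ?_, ?_⟩
    · rw [closure_eq_compl_interior_compl, hne.2, Set.compl_empty]
    · rw [closure_compl, hne.1, Set.compl_empty]
  · rintro hA ⟨U, hU, hUne, hUA, hUA'⟩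
    rcases hA with hA | hA
    · obtain ⟨x, hxU, hxA⟩ := h U _ hU isOpen_interior hUne hA
      have := hUA' hxU
      rw [closure_compl] at this
      exact this hxA
    · obtain ⟨x, hxU, hxA⟩ := h U _ hU isOpen_interior hUne hA
      have := hUA hxU
      rw [closure_eq_compl_interior_compl] at this
      exact this hxA

theorem interior_nonempty_iff_UF {X E : Type*} (R : X × E × X → Bool) (A : Set X) :
    (@interior X (trel R) A).Nonempty ↔
      ∃ F : Finset (List E), (UF R F).Nonempty ∧ UF R F ⊆ A := by
  let := trel R
  constructor
  · intro h
    obtain ⟨F, hF, hFA⟩ := exists_UF_subset isOpen_interior h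
    exact ⟨F, hF, hFA.trans interior_subset⟩
  · rintro ⟨F, hF, hFA⟩
    exact hF.mono (interior_maximal hFA (isOpen_UF R F))

theorem isClosed_setOf_forall_mem_eq_s17 {X : Type*} (S : Set X) (b : Bool) :
    IsClosed {f : X → Bool | ∀ x ∈ S, f x = b} := by
  simp only [Set.ofPred_forall]
  exact isClosed_biInter fun x _ ↦ isClosed_eq (continuous_apply x) continuous_const

theorem exists_isClosed_monitorable_eq_iUnion {X E : Type*} [Nonempty X] [Countable E]
    {R : X × E × X → Bool}
    (h : ∀ U V : Set X, IsOpen[trel R] U → IsOpen[trel R] V → U.Nonempty → V.Nonempty →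
      (U ∩ V).Nonempty) :
    ∃ F : ℕ → Set (X → Bool), (∀ n, IsClosed (F n)) ∧
      {f : X → Bool | @Monitorable X (trel R) {x : X | f x = true}} = ⋃ n, F n := by
  obtain ⟨e, he⟩ := exists_surjective_nat (Finset (List E))
  refine ⟨fun n ↦ {f | (UF R (e n)).Nonempty ∧
    ((∀ x ∈ UF R (e n), f x = true) ∨ ∀ x ∈ UF R (e n), f x = false)}, fun n ↦ ?_, ?_⟩
  · exact isClosed_const.inter ((isClosed_setOf_forall_mem_eq_s17 _ true).union
      (isClosed_setOf_forall_mem_eq_s17 _ false))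
  · ext f
    let := trel R
    rw [Set.mem_ofPred_eq, monitorable_iff_of_hyperconnected h, interior_nonempty_iff_UF,
      interior_nonempty_iff_UF, ← exists_or, he.exists, Set.mem_iUnion]
    simp only [← and_or_left, Set.subset_def, Set.mem_ofPred_eq, Set.mem_compl_iff,
      Bool.not_eq_true]

/-- The set of transition relations `R` whose topology `T_R` is hyperconnected is a dense
`Gδ` subset of `P(X × E × X)`; consequently, the set of `R` for which the family of
monitorable subsets of `(X, T_R)` is a countable union of closed subsets of `P(X)` is
comeagre in `P(X × E × X)`. -/
theorem hyperconnected_dense_Gdelta_and_monitorable_Sigma02_comeagre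
    {X E : Type*} [Countable X] [Infinite X] [Countable E] [Nonempty E] :
    (IsGδ {R : X × E × X → Bool | ∀ U V : Set X,
        IsOpen[trel R] U → IsOpen[trel R] V → U.Nonempty → V.Nonempty →
          (U ∩ V).Nonempty} ∧
      Dense {R : X × E × X → Bool | ∀ U V : Set X,
        IsOpen[trel R] U → IsOpen[trel R] V → U.Nonempty → V.Nonempty →
          (U ∩ V).Nonempty}) ∧
    {R : X × E × X → Bool | ∃ F : ℕ → Set (X → Bool), (∀ n, IsClosed (F n)) ∧
        {f : X → Bool | @Monitorable X (trel R) {x : X | f x = true}} = ⋃ n, F n} ∈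
      residual ((X × E × X) → Bool) := by
  exact ⟨⟨isGδ_setOf_hyperconnected, dense_setOf_hyperconnected⟩,
    Filter.mem_of_superset
      (residual_of_dense_Gδ isGδ_setOf_hyperconnected dense_setOf_hyperconnected)
      fun _ hR ↦ exists_isClosed_monitorable_eq_iUnion hR⟩
end

section
/- Let Y be a nonempty hyperconnected topological space (i.e., any two nonempty open subsets of Y intersect) and let A ⊆ Y. Then the following are equivalent: (1) A is monitorable; (2) the frontier of A is not all of Y; (3) the interior of A is nonempty or the interior of Y \ A is nonempty. -/
/-- In a nonempty hyperconnected space, a set `A` is monitorable iff its frontier is not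
the whole space, iff `A` or its complement has nonempty interior. -/
theorem monitorable_iff_hyperconnected {Y : Type*} [TopologicalSpace Y] [Nonempty Y]
    (hY : ∀ U V : Set Y, IsOpen U → IsOpen V → U.Nonempty → V.Nonempty →
      (U ∩ V).Nonempty) (A : Set Y) :
    (Monitorable A ↔ closure A \ interior A ≠ Set.univ) ∧
    (Monitorable A ↔ (interior A).Nonempty ∨ (interior Aᶜ).Nonempty) := by
  have monitorable_iff :
      Monitorable A ↔ (interior A).Nonempty ∨ (interior Aᶜ).Nonempty := by
    constructor
    · intro h
      by_contra! hne
      refine h ⟨Set.univ, isOpen_univ, Set.univ_nonempty, ?_, ?_⟩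
      · rw [closure_eq_compl_interior_compl, hne.2, Set.compl_empty]
      · rw [closure_compl, hne.1, Set.compl_empty]
    · rintro h ⟨U, hUo, hUn, hUA, hUAc⟩
      rcases h with h | h
      · obtain ⟨x, hxU, hxA⟩ := hY U _ hUo isOpen_interior hUn h
        have hx := hUAc hxU
        rw [closure_compl] at hx
        exact hx hxA
      · obtain ⟨x, hxU, hxA⟩ := hY U _ hUo isOpen_interior hUn h
        rw [interior_compl] at hxA
        exact hxA (hUA hxU)
  refine ⟨monitorable_iff.trans ?_, monitorable_iff⟩
  rw [Set.ne_univ_iff_exists_notMem, interior_compl, ← Set.union_nonempty]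
  refine exists_congr fun x => ?_
  simp only [Set.mem_union, Set.mem_compl_iff, Set.mem_sdiff]
  tauto
end

section
/- Let X = ℕ^{<ω} ∪ {∞} be ordered by: x ≤ y iff (x, y ∈ ℕ^{<ω} and x is a prefix of y) or y = ∞, and endow X with the topology whose open sets are exactly the empty set and the upward closed sets U that intersect every infinite branch (i.e., for every α : ℕ → ℕ there is n with the initial segment α|n ∈ U). Then for every tree T on ℕ (i.e., T ⊆ ℕ^{<ω} closed under taking prefixes), the set T, viewed as a subset of X, is monitorable if and only if T is well founded, i.e., there is no α : ℕ → ℕ all of whose finite initial segments belong to T. -/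
open Topology

/-- On the space `X = ℕ^{<ω} ∪ {∞}` (here `Option (List ℕ)`, with `none` playing the role
of `∞`), whose open sets are exactly `∅` and the upward closed sets meeting every infinite
branch, a tree `T ⊆ ℕ^{<ω}` is monitorable (as a subset of `X`) iff it is well founded. -/
theorem tree_monitorable_iff_wellFounded (t : TopologicalSpace (Option (List ℕ)))
    (ht : ∀ U : Set (Option (List ℕ)),
      IsOpen[t] U ↔
        U = ∅ ∨
          ((∀ x ∈ U, ∀ y : Option (List ℕ),
              (y = none ∨ ∃ s u : List ℕ, x = some s ∧ y = some u ∧ s <+: u) → y ∈ U) ∧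
            ∀ α : ℕ → ℕ, ∃ n : ℕ, some ((List.range n).map α) ∈ U))
    (T : Set (List ℕ)) (hT : ∀ s u : List ℕ, s <+: u → u ∈ T → s ∈ T) :
    @Monitorable (Option (List ℕ)) t (Option.some '' T) ↔
      ¬ ∃ α : ℕ → ℕ, ∀ n : ℕ, (List.range n).map α ∈ T := by
  have none_mem : ∀ U : Set (Option (List ℕ)), IsOpen[t] U → U.Nonempty → none ∈ U := by
    rintro U hU ⟨x, hx⟩
    rcases (ht U).1 hU with rfl | ⟨hup, -⟩
    · exact hx.elim
    · exact hup x hx none (Or.inl rfl)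
  have none_mem_compl : (none : Option (List ℕ)) ∈ (Option.some '' T)ᶜ := by simp
  constructor
  · rintro hmon ⟨α, hα⟩
    refine hmon ⟨Set.univ, isOpen_univ, Set.univ_nonempty, fun x _ => ?_, fun x _ => ?_⟩
    · refine mem_closure_iff.2 fun V hV hx => ?_
      rcases (ht V).1 hV with rfl | ⟨-, hbranch⟩
      · exact hx.elim
      · obtain ⟨n, hn⟩ := hbranch α
        exact ⟨_, hn, Set.mem_image_of_mem _ (hα n)⟩
    · exact mem_closure_iff.2 fun V hV hx => ⟨none, none_mem V hV ⟨x, hx⟩, none_mem_compl⟩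
  · rintro hwf ⟨U, hU, hne, hcl, -⟩
    have hopen : IsOpen[t] (Option.some '' T)ᶜ := by
      refine (ht _).2 (Or.inr ⟨?_, fun α => ?_⟩)
      · rintro x hx y (rfl | ⟨s, u, rfl, rfl, hsu⟩)
        · exact none_mem_compl
        · rintro ⟨v, hv, hvu⟩
          obtain rfl := Option.some.inj hvu
          exact hx (Set.mem_image_of_mem _ (hT s v hsu hv))
      · by_contra! h
        refine hwf ⟨α, fun n => ?_⟩
        simpa using h n
    obtain ⟨x, hx, hxT⟩ := mem_closure_iff.1 (hcl (none_mem U hU hne)) _ hopen none_mem_compl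
    exact hx hxT
end
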